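/- arXiv:2604.22395 — 3 statements merged into one kernel-verified Lean document; each statement's English description precedes it below -/
import Mathlib

section
/- Let G1 and G2 be vertex-disjoint simple graphs, each of girth at least g, with edges x1y1 in G1 and x2y2 in G2. Then the graph Γ on V(G1) ∪ V(G2) with edge set (E(G1) ∪ E(G2) ∪ {x1x2, y1y2}) \ {x1y1, x2y2} has girth at least g. -/
open SimpleGraph Set

/-- The degree of a vertex, via the natural cardinality of its neighbor set. -/
noncomputable def deg {V : Type*} (G : SimpleGraph V) (v : V) : ℕ :=
  (G.neighborSet v).ncard

/-- Number of edges both of whose endpoints have degree `d`. -/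
noncomputable def edgeCountDeg {V : Type*} (G : SimpleGraph V) (d : ℕ) : ℕ :=
  {e ∈ G.edgeSet | ∀ v ∈ e, deg G v = d}.ncard

/-- An `(r,s;g)`-balanced biregular graph: girth `g`, degree set exactly `{r, s}`,
and equally many vertices of degree `r` as of degree `s`. -/
def IsBabi {V : Type*} (r s g : ℕ) (G : SimpleGraph V) : Prop :=
  G.girth = g ∧ (∀ v, deg G v = r ∨ deg G v = s) ∧
  (∃ v, deg G v = r) ∧ (∃ v, deg G v = s) ∧
  {v | deg G v = r}.ncard = {v | deg G v = s}.ncard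

lemma SimpleGraph.coe_girth_of_not_isAcyclic {V : Type*} {G : SimpleGraph V}
    (hG : ¬ G.IsAcyclic) : (G.girth : ℕ∞) = G.egirth :=
  ENat.natCast_toNat (egirth_eq_top.not.2 hG)

/-- Closed trails can be opened at any of their edges. -/
lemma SimpleGraph.Walk.IsTrail.exists_walk_of_mem_edges {V : Type*} {G : SimpleGraph V} {a u v : V}
    {w : G.Walk a a} (hw : w.IsTrail) (h : s(u, v) ∈ w.edges) :
    ∃ q : G.Walk u v, s(u, v) ∉ q.edges ∧ q.length + 1 = w.length := by
  have key : ∀ {b c : V} (p : G.Walk b c), s(u, v) ∈ p.edges →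
      (∃ (p₁ : G.Walk b u) (h : G.Adj u v) (p₂ : G.Walk v c), p = p₁.append (.cons h p₂)) ∨
      ∃ (p₁ : G.Walk b v) (h : G.Adj v u) (p₂ : G.Walk u c), p = p₁.append (.cons h p₂) := by
    intro b c p hp
    induction p with
    | nil => simp at hp
    | cons hadj p ih =>
      rw [Walk.edges_cons, List.mem_cons] at hp
      rcases hp with hp | hp
      · rcases Sym2.eq_iff.1 hp with ⟨rfl, rfl⟩ | ⟨rfl, rfl⟩
        · exact .inl ⟨.nil, hadj, p, rfl⟩
        · exact .inr ⟨.nil, hadj, p, rfl⟩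
      · rcases ih hp with ⟨p₁, h, p₂, rfl⟩ | ⟨p₁, h, p₂, rfl⟩
        · exact .inl ⟨.cons hadj p₁, h, p₂, rfl⟩
        · exact .inr ⟨.cons hadj p₁, h, p₂, rfl⟩
  have hnodup := hw.edges_nodup
  rcases key w h with ⟨p₁, h, p₂, rfl⟩ | ⟨p₁, h, p₂, rfl⟩
  · refine ⟨(p₂.append p₁).reverse, ?_, ?_⟩
    · simp only [Walk.edges_append, Walk.edges_cons, Walk.edges_reverse, List.nodup_append,
        List.nodup_cons, List.mem_reverse, List.mem_append] at hnodup ⊢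
      grind
    · simp only [Walk.length_reverse, Walk.length_append, Walk.length_cons]
      lia
  · refine ⟨p₂.append p₁, ?_, ?_⟩
    · simp only [Walk.edges_append, Walk.edges_cons, List.nodup_append,
        List.nodup_cons, List.mem_append, Sym2.eq_swap (a := v)] at hnodup ⊢
      grind
    · simp only [Walk.length_append, Walk.length_cons]
      lia

/-- A walk joining the endpoints of an edge while avoiding that edge closes up to a cycle. -/
lemma SimpleGraph.Adj.egirth_le_length_add_one {V : Type*} {G : SimpleGraph V} {u v : V}
    (h : G.Adj u v) (q : (G.deleteEdges {s(u, v)}).Walk u v) : G.egirth ≤ q.length + 1 := by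
  classical
  have hp := q.bypass_isPath.mapLe (G.deleteEdges_le {s(u, v)})
  have hcycle : (Walk.cons h.symm (q.bypass.mapLe (G.deleteEdges_le {s(u, v)}))).IsCycle := by
    refine (Walk.cons_isCycle_iff _ _).2 ⟨hp, fun hmem => ?_⟩
    rw [Walk.edges_mapLe_eq_edges] at hmem
    simpa [Sym2.eq_swap] using Walk.edges_subset_edgeSet _ hmem
  refine (egirth_le_length hcycle).trans ?_
  have := q.length_bypass_le_length
  simp only [Walk.length_cons, Walk.length_map, Walk.mapLe]
  exact_mod_cast Nat.succ_le_succ this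

/-- A walk in `H` that starts in the range of `f` either stays there and lifts along `f`, or its
part before the first exit lifts to a walk ending at an exit vertex. -/
lemma SimpleGraph.Walk.exists_lift_or_exit {V W : Type*} {H : SimpleGraph W} {K : SimpleGraph V}
    {f : V → W} {T : V → Prop}
    (hf : ∀ a w, H.Adj (f a) w → (∃ b, w = f b ∧ K.Adj a b) ∨ T a)
    {a : V} {v : W} (p : H.Walk (f a) v) :
    (∃ b, v = f b ∧ ∃ q : K.Walk a b, q.length = p.length) ∨
      ∃ t, T t ∧ ∃ q : K.Walk a t, q.length < p.length := by
  generalize hu : f a = u at p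
  induction p generalizing a with
  | nil => exact .inl ⟨a, hu.symm, .nil, rfl⟩
  | cons h p ih =>
    subst hu
    rcases hf _ _ h with ⟨b, rfl, hab⟩ | ht
    · rcases ih rfl with ⟨c, hc, q, hq⟩ | ⟨t, ht, q, hq⟩
      · exact .inl ⟨c, hc, .cons hab q, by simp [hq]⟩
      · exact .inr ⟨t, ht, .cons hab q, by simpa using hq⟩
    · exact .inr ⟨a, ht, .nil, by simp⟩

/-- A cycle of `H` through a vertex of a union of components embedded in `G` bounds the girth
of `G`. -/
lemma SimpleGraph.Walk.IsCycle.egirth_le_length_of_forall_adj {V W : Type*} {H : SimpleGraph W}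
    {G : SimpleGraph V} {f : V → W} (hinj : Function.Injective f)
    (hf : ∀ a w, H.Adj (f a) w → ∃ b, w = f b ∧ G.Adj a b)
    {a : V} {w : H.Walk (f a) (f a)} (hw : w.IsCycle) : G.egirth ≤ w.length := by
  have hadj := w.adj_snd hw.not_nil
  obtain ⟨b, hb, hab⟩ := hf _ _ hadj
  have hmem : s(f a, f b) ∈ w.edges := hb ▸ w.mk_start_snd_mem_edges hw.not_nil
  obtain ⟨q, hq, hlen⟩ := hw.isTrail.exists_walk_of_mem_edges hmem
  have hlift : ∀ c w, (H.deleteEdges {s(f a, f b)}).Adj (f c) w →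
      (∃ d, w = f d ∧ (G.deleteEdges {s(a, b)}).Adj c d) ∨ False := by
    intro c w hcw
    rw [deleteEdges_adj] at hcw
    obtain ⟨d, rfl, hcd⟩ := hf _ _ hcw.1
    refine .inl ⟨d, rfl, deleteEdges_adj.2 ⟨hcd, fun h => hcw.2 ?_⟩⟩
    exact congrArg (Sym2.map f) h
  rcases (q.toDeleteEdges {s(f a, f b)} (by grind)).exists_lift_or_exit hlift with
    ⟨c, hc, r, hr⟩ | ⟨t, ht, -⟩
  · obtain rfl := hinj hc
    refine (hab.egirth_le_length_add_one r).trans ?_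
    rw [hr, ← hlen]
    simp [Walk.toDeleteEdges]
  · exact ht.elim

lemma SimpleGraph.reachable_deleteEdges_of_not_isAcyclic {V : Type*} {G : SimpleGraph V} {x y : V}
    (hG : ¬ G.IsAcyclic) (hdel : (G.deleteEdges {s(x, y)}).IsAcyclic) :
    (G.deleteEdges {s(x, y)}).Reachable x y := by
  simp only [IsAcyclic, not_forall, not_not] at hG
  obtain ⟨u, w, hw⟩ := hG
  refine (adj_and_reachable_delete_edges_iff_exists_cycle.2 ⟨u, w, hw, ?_⟩).2
  by_contra hmem
  exact hdel _ (hw.toDeleteEdges _ {s(x, y)} (by grind))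

/-- The union of two disjoint graphs in which the edges `x1 y1` and `x2 y2` are replaced by
`x1 x2` and `y1 y2`. -/
def edgeSwitch {V1 V2 : Type*} (G1 : SimpleGraph V1) (G2 : SimpleGraph V2)
    (x1 y1 : V1) (x2 y2 : V2) : SimpleGraph (V1 ⊕ V2) :=
  SimpleGraph.fromEdgeSet
      (((Sym2.map (Sum.inl : V1 → V1 ⊕ V2) '' G1.edgeSet ∪
         Sym2.map (Sum.inr : V2 → V1 ⊕ V2) '' G2.edgeSet) ∪
        {s((Sum.inl x1 : V1 ⊕ V2), Sum.inr x2), s((Sum.inl y1 : V1 ⊕ V2), Sum.inr y2)}) \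
       {s((Sum.inl x1 : V1 ⊕ V2), Sum.inl y1), s((Sum.inr x2 : V1 ⊕ V2), Sum.inr y2)})

namespace edgeSwitch

variable {V1 V2 : Type*} {G1 : SimpleGraph V1} {G2 : SimpleGraph V2} {x1 y1 : V1} {x2 y2 : V2}

lemma comm : edgeSwitch G1 G2 y1 x1 y2 x2 = edgeSwitch G1 G2 x1 y1 x2 y2 := by
  simp only [edgeSwitch, Sym2.eq_swap (a := Sum.inl y1) (b := Sum.inl x1),
    Sym2.eq_swap (a := Sum.inr y2) (b := Sum.inr x2), Set.pair_comm s(Sum.inl y1, Sum.inr y2)]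

lemma adj_inl_inl {a b : V1} : (edgeSwitch G1 G2 x1 y1 x2 y2).Adj (.inl a) (.inl b) ↔
    (G1.deleteEdges {s(x1, y1)}).Adj a b := by
  have hmem : s((Sum.inl a : V1 ⊕ V2), Sum.inl b) ∈ Sym2.map Sum.inl '' G1.edgeSet ↔
      G1.Adj a b :=
    (Sym2.map.injective Sum.inl_injective).mem_set_image (a := s(a, b))
  have hnot : s((Sum.inl a : V1 ⊕ V2), Sum.inl b) ∉ Sym2.map Sum.inr '' G2.edgeSet := by
    rintro ⟨⟨c, d⟩, -, h⟩
    simp at h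
  have := G1.ne_of_adj (a := a) (b := b)
  simp [edgeSwitch, hmem, hnot]
  tauto

lemma adj_inr_inr {a b : V2} : (edgeSwitch G1 G2 x1 y1 x2 y2).Adj (.inr a) (.inr b) ↔
    (G2.deleteEdges {s(x2, y2)}).Adj a b := by
  have hmem : s((Sum.inr a : V1 ⊕ V2), Sum.inr b) ∈ Sym2.map Sum.inr '' G2.edgeSet ↔
      G2.Adj a b :=
    (Sym2.map.injective Sum.inr_injective).mem_set_image (a := s(a, b))
  have hnot : s((Sum.inr a : V1 ⊕ V2), Sum.inr b) ∉ Sym2.map Sum.inl '' G1.edgeSet := by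
    rintro ⟨⟨c, d⟩, -, h⟩
    simp at h
  have := G2.ne_of_adj (a := a) (b := b)
  simp [edgeSwitch, hmem, hnot]
  tauto

lemma adj_inl_inr {a : V1} {b : V2} : (edgeSwitch G1 G2 x1 y1 x2 y2).Adj (.inl a) (.inr b) ↔
    a = x1 ∧ b = x2 ∨ a = y1 ∧ b = y2 := by
  have hnot1 : s((Sum.inl a : V1 ⊕ V2), Sum.inr b) ∉ Sym2.map Sum.inl '' G1.edgeSet := by
    rintro ⟨⟨c, d⟩, -, h⟩
    simp at h
  have hnot2 : s((Sum.inl a : V1 ⊕ V2), Sum.inr b) ∉ Sym2.map Sum.inr '' G2.edgeSet := by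
    rintro ⟨⟨c, d⟩, -, h⟩
    simp at h
  simp [edgeSwitch, hnot1, hnot2]

lemma egirth_left_le_length_of_mem_edges (h1 : G1.Adj x1 y1) {u : V1 ⊕ V2}
    {w : (edgeSwitch G1 G2 x1 y1 x2 y2).Walk u u} (hw : w.IsCycle)
    (hmem : s(Sum.inl x1, Sum.inr x2) ∈ w.edges) : G1.egirth ≤ w.length := by
  obtain ⟨q, hq, hlen⟩ := hw.isTrail.exists_walk_of_mem_edges hmem
  have hlift : ∀ a v, ((edgeSwitch G1 G2 x1 y1 x2 y2).deleteEdges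
      {s(Sum.inl x1, Sum.inr x2)}).Adj (.inl a) v →
      (∃ b, v = .inl b ∧ (G1.deleteEdges {s(x1, y1)}).Adj a b) ∨ a = y1 := by
    rintro a (b | b) hab <;> rw [deleteEdges_adj] at hab
    · exact .inl ⟨b, rfl, adj_inl_inl.1 hab.1⟩
    · rcases adj_inl_inr.1 hab.1 with ⟨rfl, rfl⟩ | ⟨rfl, -⟩
      · exact (hab.2 rfl).elim
      · exact .inr rfl
  rcases (q.toDeleteEdges {s(Sum.inl x1, Sum.inr x2)} (by grind)).exists_lift_or_exit hlift with
    ⟨b, hb, -⟩ | ⟨t, rfl, r, hr⟩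
  · simp at hb
  · refine (h1.egirth_le_length_add_one r).trans ?_
    simp only [Walk.toDeleteEdges, Walk.length_transfer] at hr
    norm_cast
    lia

theorem min_egirth_le_egirth (h1 : G1.Adj x1 y1) :
    min G1.egirth G2.egirth ≤ (edgeSwitch G1 G2 x1 y1 x2 y2).egirth := by
  refine le_egirth.2 fun u w hw => ?_
  by_cases hx : s(Sum.inl x1, Sum.inr x2) ∈ w.edges
  · exact min_le_of_left_le (egirth_left_le_length_of_mem_edges h1 hw hx)
  by_cases hy : s(Sum.inl y1, Sum.inr y2) ∈ w.edges
  · refine min_le_of_left_le ?_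
    generalize hΓ : edgeSwitch G1 G2 x1 y1 x2 y2 = Γ at w
    rw [← comm] at hΓ
    subst hΓ
    exact egirth_left_le_length_of_mem_edges h1.symm hw hy
  let H := (edgeSwitch G1 G2 x1 y1 x2 y2).deleteEdges
    {s(Sum.inl x1, Sum.inr x2), s(Sum.inl y1, Sum.inr y2)}
  have hcross : ∀ a b, ¬ H.Adj (.inl a) (.inr b) := by
    intro a b hab
    rw [deleteEdges_adj, adj_inl_inr] at hab
    rcases hab with ⟨⟨rfl, rfl⟩ | ⟨rfl, rfl⟩, hab⟩ <;> simp at hab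
  have havoid : ∀ e ∈ w.edges,
      e ∉ ({s(Sum.inl x1, Sum.inr x2), s(Sum.inl y1, Sum.inr y2)} : Set (Sym2 (V1 ⊕ V2))) := by
    rintro e he (rfl | rfl) <;> contradiction
  have hdel := hw.toDeleteEdges _ _ havoid
  have hlen : (w.toDeleteEdges _ havoid).length = w.length := w.length_transfer _
  rw [← hlen]
  rcases u with a | a
  · refine min_le_of_left_le (hdel.egirth_le_length_of_forall_adj Sum.inl_injective ?_)
    rintro a (b | b) hab
    · exact ⟨b, rfl, (deleteEdges_adj.1 (adj_inl_inl.1 (deleteEdges_adj.1 hab).1)).1⟩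
    · exact (hcross _ _ hab).elim
  · refine min_le_of_right_le (hdel.egirth_le_length_of_forall_adj Sum.inr_injective ?_)
    rintro a (b | b) hab
    · exact (hcross _ _ hab.symm).elim
    · exact ⟨b, rfl, (deleteEdges_adj.1 (adj_inr_inr.1 (deleteEdges_adj.1 hab).1)).1⟩

lemma not_isAcyclic (hadj : G1.Adj x1 y1) (h1 : ¬ G1.IsAcyclic) (h2 : ¬ G2.IsAcyclic) :
    ¬ (edgeSwitch G1 G2 x1 y1 x2 y2).IsAcyclic := by
  intro hΓ
  let H := (edgeSwitch G1 G2 x1 y1 x2 y2).deleteEdges {s(Sum.inl x1, Sum.inr x2)}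
  have hH : H.IsAcyclic := hΓ.anti (deleteEdges_le _)
  let f1 : G1.deleteEdges {s(x1, y1)} →g H :=
    ⟨Sum.inl, fun h => deleteEdges_adj.2 ⟨adj_inl_inl.2 h, by simp⟩⟩
  let f2 : G2.deleteEdges {s(x2, y2)} →g H :=
    ⟨Sum.inr, fun h => deleteEdges_adj.2 ⟨adj_inr_inr.2 h, by simp⟩⟩
  have hr1 := (reachable_deleteEdges_of_not_isAcyclic h1 (hH.comap f1 Sum.inl_injective)).map f1
  have hr2 := (reachable_deleteEdges_of_not_isAcyclic h2 (hH.comap f2 Sum.inr_injective)).map f2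
  have hy : H.Adj (.inl y1) (.inr y2) :=
    deleteEdges_adj.2 ⟨adj_inl_inr.2 (.inr ⟨rfl, rfl⟩), by simp [hadj.ne']⟩
  exact isAcyclic_iff_forall_isBridge.1 hΓ (e := s(Sum.inl x1, Sum.inr x2))
    (adj_inl_inr.2 (.inl ⟨rfl, rfl⟩)) ((hr1.trans hy.reachable).trans hr2.symm)

end edgeSwitch

/-- the connection of two graphs through switching two edges has
girth at least `g` if both graphs have girth at least `g`. -/
theorem stmt_4 {V1 V2 : Type*} (G1 : SimpleGraph V1) (G2 : SimpleGraph V2)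
    (g : ℕ∞) (x1 y1 : V1) (x2 y2 : V2)
    (h1 : G1.Adj x1 y1) (h2 : G2.Adj x2 y2)
    (hg1 : g ≤ G1.girth) (hg2 : g ≤ G2.girth) :
    g ≤ (SimpleGraph.fromEdgeSet
      (((Sym2.map (Sum.inl : V1 → V1 ⊕ V2) '' G1.edgeSet ∪
         Sym2.map (Sum.inr : V2 → V1 ⊕ V2) '' G2.edgeSet) ∪
        {s((Sum.inl x1 : V1 ⊕ V2), Sum.inr x2), s((Sum.inl y1 : V1 ⊕ V2), Sum.inr y2)}) \
       {s((Sum.inl x1 : V1 ⊕ V2), Sum.inl y1), s((Sum.inr x2 : V1 ⊕ V2), Sum.inr y2)})).girth := by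
  change g ≤ (edgeSwitch G1 G2 x1 y1 x2 y2).girth
  by_cases hG1 : G1.IsAcyclic
  · rw [girth_eq_zero.2 hG1, Nat.cast_zero] at hg1
    exact hg1.trans zero_le
  by_cases hG2 : G2.IsAcyclic
  · rw [girth_eq_zero.2 hG2, Nat.cast_zero] at hg2
    exact hg2.trans zero_le
  rw [coe_girth_of_not_isAcyclic hG1] at hg1
  rw [coe_girth_of_not_isAcyclic hG2] at hg2
  rw [coe_girth_of_not_isAcyclic (edgeSwitch.not_isAcyclic h1 hG1 hG2)]
  exact (le_min hg1 hg2).trans (edgeSwitch.min_egirth_le_egirth h1)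
end

section
/- For all integers 2 ≤ r < s and g ≥ 3, there exists a finite simple graph of girth g whose degree set is exactly {r, s} and in which the number of vertices of degree r equals the number of vertices of degree s; moreover, such a graph exists with order at most 32·(Σ_{t=1}^{g−2}(r−1)^t)·(Σ_{t=1}^{g−2}(s−1)^t). -/
open SimpleGraph Set

namespace SimpleGraph

variable {V : Type*} {G : SimpleGraph V}

/-- Adding an edge between nonadjacent vertices raises the degrees of its endpoints by one. -/
theorem deg_sup_edge [Finite V] [DecidableEq V] {u v : V} (hne : u ≠ v) (hn : ¬ G.Adj u v) (a : V) :
    deg (G ⊔ edge u v) a = deg G a + (if a = u then 1 else 0) + (if a = v then 1 else 0) := by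
  unfold deg
  by_cases hu : a = u
  · subst hu
    have : (G ⊔ edge a v).neighborSet a = insert v (G.neighborSet a) := by
      ext b
      simp only [mem_neighborSet, sup_adj, edge_adj, mem_insert_iff]
      grind
    rw [this, ncard_insert_of_notMem (by simpa using hn)]
    simp [hne]
  · by_cases hv : a = v
    · subst hv
      have : (G ⊔ edge u a).neighborSet a = insert u (G.neighborSet a) := by
        ext b
        simp only [mem_neighborSet, sup_adj, edge_adj, mem_insert_iff]
        grind
      rw [this, ncard_insert_of_notMem (by simpa using fun h => hn h.symm)]
      simp [hu]
    · have : (G ⊔ edge u v).neighborSet a = G.neighborSet a := by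
        ext b
        simp only [mem_neighborSet, sup_adj, edge_adj]
        grind
      simp [this, hu, hv]

theorem deleteEdges_sup_edge {u v : V} (h : G.Adj u v) :
    G.deleteEdges {s(u, v)} ⊔ edge u v = G := by
  ext a b
  simp only [sup_adj, deleteEdges_adj, edge_adj, mem_singleton_iff, Sym2.eq_iff]
  have := h.symm
  have := fun h : G.Adj a b => h.ne
  grind

theorem sum_deg_even [Fintype V] (G : SimpleGraph V) : Even (∑ v, deg G v) := by
  classical
  have : ∀ v, deg G v = G.degree v := fun v => by
    rw [deg, ← card_neighborSet_eq_degree, Set.ncard_eq_toFinset_card', Set.toFinset_card]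
  simp only [this, sum_degrees_eq_twice_card_edges]
  exact even_two_mul _

/-- A walk that uses an added edge splits off an initial and a final walk avoiding it. -/
theorem edist_le_length_or_of_sup_edge {x z a b : V} (p : (G ⊔ edge x z).Walk a b) :
    G.edist a b ≤ p.length ∨ ∃ c d, (c = x ∨ c = z) ∧ (d = x ∨ d = z) ∧
      G.edist a c + G.edist d b + 1 ≤ p.length := by
  induction p with
  | nil => simp
  | @cons a a' b h p ih =>
    rw [sup_adj, edge_adj] at h
    rcases h with h | ⟨h, -⟩
    · have h1 : G.edist a a' = 1 := edist_eq_one_iff_adj.2 h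
      rcases ih with ih | ⟨c, d, hc, hd, ih⟩
      · left
        calc G.edist a b ≤ G.edist a a' + G.edist a' b := SimpleGraph.edist_triangle
          _ ≤ 1 + p.length := by rw [h1]; gcongr
          _ = _ := by simp [add_comm]
      · right
        refine ⟨c, d, hc, hd, ?_⟩
        calc G.edist a c + G.edist d b + 1
            ≤ (G.edist a a' + G.edist a' c) + G.edist d b + 1 := by
              gcongr; exact SimpleGraph.edist_triangle
          _ = (G.edist a' c + G.edist d b + 1) + 1 := by rw [h1]; ring
          _ ≤ p.length + 1 := by gcongr
          _ = _ := by simp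
    · right
      rcases ih with ih | ⟨c, d, hc, hd, ih⟩
      · refine ⟨a, a', by tauto, by tauto, ?_⟩
        simpa using ih
      · refine ⟨a, d, by tauto, hd, ?_⟩
        have : G.edist d b ≤ p.length := le_trans (by rw [add_right_comm]; exact le_add_self) ih
        simpa using this

theorem le_edist_iff {n : ℕ∞} {u v : V} :
    n ≤ G.edist u v ↔ ∀ p : G.Walk u v, n ≤ p.length := le_iInf_iff

theorem le_edist_sup_edge {m : ℕ∞} {x y z w : V} (hyw : m ≤ G.edist y w) (hzw : m ≤ G.edist z w)
    (hyz : m ≤ G.edist y z) : m ≤ (G ⊔ edge x z).edist y w := by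
  rw [le_edist_iff]
  intro p
  rcases edist_le_length_or_of_sup_edge p with h | ⟨c, d, hc, hd, h⟩
  · exact hyw.trans h
  · refine le_trans ?_ (le_self_add.trans h)
    rcases hc with rfl | rfl
    · rcases hd with rfl | rfl
      · exact hyw.trans SimpleGraph.edist_triangle
      · exact hzw.trans le_add_self
    · exact hyz.trans le_self_add

theorem le_edist_deleteEdges_of_le_egirth {m : ℕ} (hG : ((m + 1 : ℕ) : ℕ∞) ≤ G.egirth) {u v : V}
    (h : G.Adj u v) : (m : ℕ∞) ≤ (G.deleteEdges {s(u, v)}).edist u v := by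
  classical
  rw [le_edist_iff]
  intro p
  set q := p.bypass.mapLe (G.deleteEdges_le {s(u, v)}) with hq
  have hqp : q.IsPath := (p.bypass_isPath).mapLe _
  have he : s(v, u) ∉ q.edges := by
    intro he
    rw [hq, Walk.edges_mapLe_eq_edges] at he
    have := p.bypass.edges_subset_edgeSet he
    simp [Sym2.eq_swap] at this
  have hc : (Walk.cons h.symm q).IsCycle := (Walk.cons_isCycle_iff _ _).2 ⟨hqp, he⟩
  have h1 := le_egirth.1 hG _ _ hc
  have h2 : q.length ≤ p.length := by
    rw [hq, Walk.length_mapLe]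
    exact p.length_bypass_le_length
  rw [Walk.length_cons] at h1
  have h3 : m + 1 ≤ q.length + 1 := by exact_mod_cast h1
  exact_mod_cast (by omega : m ≤ p.length)

/-- An edge of a cycle is bypassed by the remainder of the cycle. -/
theorem Walk.IsCycle.exists_walk_notMem_edges {a : V} {c : G.Walk a a} (hc : c.IsCycle) {u v : V}
    (he : s(u, v) ∈ c.edges) :
    ∃ p : G.Walk u v, s(u, v) ∉ p.edges ∧ p.length + 1 ≤ c.length := by
  classical
  have huv : u ≠ v := (c.adj_of_mem_edges he).ne
  have hu := c.fst_mem_support_of_mem_edges he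
  set d := c.rotate u hu with hd
  have hdc : d.IsCycle := hc.rotate hu
  have hed : s(u, v) ∈ d.edges := (c.rotate_edges u hu).mem_iff.2 he
  have hv : v ∈ d.support := d.snd_mem_support_of_mem_edges hed
  have hlen : d.length = c.length := by
    rw [← Walk.length_edges, ← Walk.length_edges, (c.rotate_edges u hu).perm.length_eq]
  have hs := d.take_spec hv
  have hl : (d.takeUntil v hv).length + (d.dropUntil v hv).length = d.length := by
    rw [← Walk.length_append, hs]
  have hnd := hdc.edges_nodup
  rw [← hs, Walk.edges_append] at hnd
  have hdis := List.disjoint_of_nodup_append hnd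
  have ht : 0 < (d.takeUntil v hv).length :=
    Nat.pos_of_ne_zero fun h => huv (Walk.eq_of_length_eq_zero h)
  have hr : 0 < (d.dropUntil v hv).length :=
    Nat.pos_of_ne_zero fun h => huv (Walk.eq_of_length_eq_zero h).symm
  by_cases h : s(u, v) ∈ (d.takeUntil v hv).edges
  · refine ⟨(d.dropUntil v hv).reverse, ?_, ?_⟩
    · rw [Walk.edges_reverse, List.mem_reverse]
      exact hdis h
    · rw [Walk.length_reverse]; omega
  · exact ⟨d.takeUntil v hv, h, by omega⟩

theorem le_egirth_sup_edge {m : ℕ} (hG : ((m + 1 : ℕ) : ℕ∞) ≤ G.egirth) {u v : V}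
    (h : (m : ℕ∞) ≤ G.edist u v) : ((m + 1 : ℕ) : ℕ∞) ≤ (G ⊔ edge u v).egirth := by
  have key : ∀ e, e ∈ (G ⊔ edge u v).edgeSet → e ≠ s(u, v) → e ∈ G.edgeSet := by
    intro e
    induction e with | _ a b
    simp only [mem_edgeSet, sup_adj, edge_adj, ne_eq, Sym2.eq_iff]
    tauto
  rw [le_egirth]
  intro a c hc
  by_cases he : s(u, v) ∈ c.edges
  · obtain ⟨p, hp, hl⟩ := hc.exists_walk_notMem_edges he
    have h1 := le_edist_iff.1 h (p.transfer G fun e hep =>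
      key e (p.edges_subset_edgeSet hep) (by rintro rfl; exact hp hep))
    rw [Walk.length_transfer] at h1
    have h1 : m ≤ p.length := by exact_mod_cast h1
    exact_mod_cast (by omega : m + 1 ≤ c.length)
  · have hh : ∀ e ∈ c.edges, e ∈ G.edgeSet := fun e hep =>
      key e (c.edges_subset_edgeSet hep) (by rintro rfl; exact he hep)
    have h1 := le_egirth.1 hG _ _ (hc.transfer hh)
    rwa [Walk.length_transfer] at h1

theorem ne_and_not_adj_of_two_le_edist {u v : V} (h : 2 ≤ G.edist u v) : u ≠ v ∧ ¬ G.Adj u v := by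
  have : ¬ G.edist u v ≤ 1 := fun h' => absurd (h.trans h') (by decide)
  rw [edist_le_one_iff_adj_or_eq] at this
  tauto

/-- Replacing an edge `zw` by `xz` and `yw`, for `z`, `w` far from `x` and `y`, keeps the girth
large and raises only the degrees of `x` and `y`. -/
theorem exists_switch [Finite V] [DecidableEq V] {m : ℕ} (hm : 2 ≤ m)
    (hG : ((m + 1 : ℕ) : ℕ∞) ≤ G.egirth) {x y z w : V}
    (hzw : G.Adj z w) (hxz : (m : ℕ∞) ≤ G.edist x z) (hyz : (m : ℕ∞) ≤ G.edist y z)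
    (hyw : (m : ℕ∞) ≤ G.edist y w) :
    ∃ G' : SimpleGraph V, G.deleteEdges {s(z, w)} ≤ G' ∧ ((m + 1 : ℕ) : ℕ∞) ≤ G'.egirth ∧
      ∀ v, deg G' v = deg G v + (if v = x then 1 else 0) + (if v = y then 1 else 0) := by
  set H := G.deleteEdges {s(z, w)} with hH
  have hle : H ≤ G := G.deleteEdges_le _
  have hm' : (2 : ℕ∞) ≤ m := by exact_mod_cast hm
  have far : ∀ {a b}, (m : ℕ∞) ≤ G.edist a b → (m : ℕ∞) ≤ H.edist a b :=
    fun h => h.trans (edist_anti hle)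
  have g1 := le_egirth_sup_edge (hG.trans (egirth_anti hle)) (far hxz)
  have d2 : (m : ℕ∞) ≤ (H ⊔ edge x z).edist y w :=
    le_edist_sup_edge (far hyw) (le_edist_deleteEdges_of_le_egirth hG hzw) (far hyz)
  refine ⟨H ⊔ edge x z ⊔ edge y w, le_sup_of_le_left le_sup_left, le_egirth_sup_edge g1 d2, ?_⟩
  intro v
  obtain ⟨n1, a1⟩ := ne_and_not_adj_of_two_le_edist (hm'.trans (far hxz))
  obtain ⟨n2, a2⟩ := ne_and_not_adj_of_two_le_edist (hm'.trans d2)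
  have h3 := deg_sup_edge (G := H) hzw.ne (by simp [hH]) v
  rw [hH, deleteEdges_sup_edge hzw, ← hH] at h3
  rw [deg_sup_edge n2 a2, deg_sup_edge n1 a1, h3]
  ring

theorem exists_adj_edist_eq {x v : V} {t : ℕ} (h : G.edist x v = (t + 1 : ℕ)) :
    ∃ u, G.Adj v u ∧ G.edist x u = t := by
  rw [edist_comm] at h
  obtain ⟨p, hp⟩ := exists_walk_of_edist_eq_coe h
  cases p with
  | nil => simp at hp
  | @cons _ u _ hadj q =>
    refine ⟨u, hadj, ?_⟩
    have hq : q.length = t := by simpa using hp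
    rw [edist_comm]
    refine le_antisymm (hq ▸ edist_le q) ?_
    have h1 : G.edist v x ≤ G.edist v u + G.edist u x := SimpleGraph.edist_triangle
    rw [h, edist_eq_one_iff_adj.2 hadj, add_comm 1] at h1
    push_cast at h1
    exact (ENat.add_le_add_iff_right (by decide)).1 h1

/-- Size of a sphere around a vertex of degree less than `k`, where all degrees are at most `k`. -/
theorem ncard_sphere_le [Finite V] {k : ℕ} (hk : ∀ v, deg G v ≤ k) {x : V}
    (hx : deg G x + 1 ≤ k) (t : ℕ) : {v | G.edist x v = t}.ncard ≤ (k - 1) ^ t := by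
  classical
  have := Fintype.ofFinite V
  induction t with
  | zero => simp
  | succ t ih =>
    have hS : ∀ v, G.edist x v = t →
        {u | G.Adj v u ∧ G.edist x u = (t + 1 : ℕ)}.ncard ≤ k - 1 := by
      intro v hv
      cases t with
      | zero =>
        obtain rfl : x = v := by simpa using hv
        exact (ncard_le_ncard (fun u hu => hu.1)).trans (Nat.le_sub_one_of_lt hx)
      | succ t =>
        obtain ⟨u₀, hu₀, he⟩ := exists_adj_edist_eq hv
        have hsub : {u | G.Adj v u ∧ G.edist x u = (t + 1 + 1 : ℕ)} ⊆ G.neighborSet v \ {u₀} := by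
          rintro u ⟨hu, hu'⟩
          refine ⟨hu, ?_⟩
          rintro rfl
          rw [he] at hu'
          have : t = t + 1 + 1 := by exact_mod_cast hu'
          omega
        refine (ncard_le_ncard hsub).trans ?_
        rw [ncard_sdiff_singleton_of_mem (s := G.neighborSet v) hu₀]
        exact Nat.sub_le_sub_right (hk v) 1
    have hsub : {v | G.edist x v = (t + 1 : ℕ)}.toFinset ⊆
        {v | G.edist x v = t}.toFinset.biUnion
          fun v => {u | G.Adj v u ∧ G.edist x u = (t + 1 : ℕ)}.toFinset := by
      intro v hv
      rw [mem_toFinset] at hv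
      obtain ⟨u, hu, he⟩ := exists_adj_edist_eq hv
      exact Finset.mem_biUnion.2 ⟨u, by simpa using he, by simpa using ⟨hu.symm, by simpa using hv⟩⟩
    rw [ncard_eq_toFinset_card'] at ih ⊢
    calc _ ≤ _ := Finset.card_le_card hsub
      _ ≤ _ := Finset.card_biUnion_le_card_mul _ _ (k - 1) fun v hv => by
          rw [← ncard_eq_toFinset_card']
          exact hS v (by simpa using hv)
      _ ≤ (k - 1) ^ t * (k - 1) := by gcongr
      _ = _ := (pow_succ _ _).symm

theorem ncard_ball_le [Finite V] {k : ℕ} (hk : ∀ v, deg G v ≤ k) {x : V}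
    (hx : deg G x + 1 ≤ k) (m : ℕ) :
    {v | G.edist x v < m}.ncard ≤ ∑ t ∈ Finset.range m, (k - 1) ^ t := by
  induction m with
  | zero => simp
  | succ m ih =>
    have : {v | G.edist x v < (m + 1 : ℕ)} = {v | G.edist x v < m} ∪ {v | G.edist x v = m} := by
      ext v
      simp only [mem_ofPred_eq, mem_union, ← le_iff_lt_or_eq]
      push_cast
      exact Order.lt_add_one_iff_of_not_isMax (by simp)
    rw [this, Finset.sum_range_succ]
    exact (ncard_union_le _ _).trans (add_le_add ih (ncard_sphere_le hk hx m))

/-- Double counting: if all neighbours of the full-degree set `O` lie in `I`, and some vertex of `I`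
is deficient, then `O` is smaller than `I`. -/
theorem card_lt_card_of_neighborSet_subset [Fintype V] {k : ℕ} (hk : ∀ v, deg G v ≤ k)
    {O I : Finset V} (hO : ∀ v ∈ O, deg G v = k) (hOI : ∀ v ∈ O, ∀ w, G.Adj v w → w ∈ I)
    {x : V} (hxI : x ∈ I) (hx : deg G x < k) : O.card < I.card := by
  classical
  have h := Finset.sum_card_bipartiteAbove_eq_sum_card_bipartiteBelow (s := O) (t := I) G.Adj
  have h1 : ∀ v ∈ O, (I.bipartiteAbove G.Adj v).card = k := by
    intro v hv
    rw [← hO v hv, deg, ← ncard_coe_finset]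
    congr 1
    ext w
    simpa [Finset.bipartiteAbove] using hOI v hv w
  have h2 : ∀ w ∈ I, (O.bipartiteBelow G.Adj w).card ≤ deg G w := by
    intro w hw
    rw [deg, ← ncard_coe_finset]
    refine ncard_le_ncard fun v hv => ?_
    simp only [Finset.bipartiteBelow, Finset.coe_filter, mem_ofPred_eq] at hv
    exact hv.2.symm
  rw [Finset.sum_congr rfl h1, Finset.sum_const, smul_eq_mul] at h
  have h3 : ∑ w ∈ I, (O.bipartiteBelow G.Adj w).card < ∑ w ∈ I, k :=
    Finset.sum_lt_sum (fun w hw => (h2 w hw).trans (hk w)) ⟨x, hxI, (h2 x hxI).trans_lt hx⟩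
  rw [← h, Finset.sum_const, smul_eq_mul] at h3
  exact lt_of_mul_lt_mul_right h3 (Nat.zero_le k)

theorem exists_switchable_edge [Fintype V] {m k : ℕ} (f : V → ℕ) (hf : ∀ v, f v ≤ k)
    (S : Finset V)
    (hT : 2 * ∑ t ∈ Finset.range m, (k - 1) ^ t + S.card ≤ {v | f v = k}.ncard)
    (hd : ∀ v, deg G v ≤ f v)
    (hnear : ∀ a b, deg G a < f a → deg G b < f b → G.edist a b < m)
    {x y : V} (hx : deg G x < f x) (hy : deg G y < f y) :
    ∃ z w, G.Adj z w ∧ z ∉ S ∧ (m : ℕ∞) ≤ G.edist x z ∧ (m : ℕ∞) ≤ G.edist y z ∧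
      ((m : ℕ∞) ≤ G.edist y w ∨ (m : ℕ∞) ≤ G.edist x w) := by
  classical
  by_contra! hcon
  have hk : ∀ v, deg G v ≤ k := fun v => (hd v).trans (hf v)
  have hBx := ncard_ball_le hk (hx.trans_le (hf x)) m
  have hBy := ncard_ball_le hk (hy.trans_le (hf y)) m
  rw [ncard_eq_toFinset_card'] at hBx hBy hT
  set Bx := {v | G.edist x v < m}.toFinset with hBx'
  set By := {v | G.edist y v < m}.toFinset with hBy'
  set T := {v | f v = k}.toFinset
  have hlt : (T \ (Bx ∪ By ∪ S)).card < (Bx ∩ By).card := by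
    refine card_lt_card_of_neighborSet_subset hk (x := x) ?_ ?_ ?_ (hx.trans_le (hf x))
    · intro v hv
      simp only [T, hBx', hBy', Finset.mem_sdiff, Finset.mem_union, mem_toFinset, mem_ofPred_eq,
        not_or, not_lt] at hv
      rw [← hv.1]
      by_contra hne
      exact absurd (hnear x v hx (lt_of_le_of_ne (hd v) hne)) (not_lt.2 hv.2.1.1)
    · intro v hv w hvw
      simp only [T, hBx', hBy', Finset.mem_sdiff, Finset.mem_union, mem_toFinset, mem_ofPred_eq,
        not_or, not_lt] at hv
      have := hcon v w hvw hv.2.2 hv.2.1.1 hv.2.1.2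
      simpa [hBx', hBy'] using this.symm
    · simpa [hBx', hBy'] using ⟨by simpa using hnear x x hx hx, hnear y x hy hx⟩
  have h1 : T.card ≤ (T \ (Bx ∪ By ∪ S)).card + (Bx ∪ By ∪ S).card :=
    (Finset.card_le_card (by intro v hv; simp; tauto)).trans (Finset.card_union_le _ _)
  have h2 := Finset.card_union_le (Bx ∪ By) S
  have h3 := Finset.card_union_add_card_inter Bx By
  omega

/-- A graph of large girth with degrees below `f` can be improved towards the degrees `f` whenever
the total deficiency is at least two. -/
theorem exists_sum_deg_lt [Fintype V] [DecidableEq V] {m k : ℕ} (hm : 2 ≤ m) (f : V → ℕ)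
    (hf : ∀ v, f v ≤ k) {C : SimpleGraph V} (S : Finset V) (hCS : ∀ a b, C.Adj a b → a ∈ S)
    (hT : 2 * ∑ t ∈ Finset.range m, (k - 1) ^ t + S.card ≤ {v | f v = k}.ncard)
    (hC : C ≤ G) (hG : ((m + 1 : ℕ) : ℕ∞) ≤ G.egirth) (hd : ∀ v, deg G v ≤ f v) {x y : V}
    (hxy : ∀ v, deg G v + (if v = x then 1 else 0) + (if v = y then 1 else 0) ≤ f v) :
    ∃ G' : SimpleGraph V, C ≤ G' ∧ ((m + 1 : ℕ) : ℕ∞) ≤ G'.egirth ∧ (∀ v, deg G' v ≤ f v) ∧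
      ∑ v, deg G v < ∑ v, deg G' v := by
  have hm' : (2 : ℕ∞) ≤ m := by exact_mod_cast hm
  by_cases hfar : ∃ a b, deg G a < f a ∧ deg G b < f b ∧ (m : ℕ∞) ≤ G.edist a b
  · obtain ⟨a, b, ha, hb, hab⟩ := hfar
    obtain ⟨hne, hn⟩ := ne_and_not_adj_of_two_le_edist (hm'.trans hab)
    refine ⟨G ⊔ edge a b, hC.trans le_sup_left, le_egirth_sup_edge hG hab, ?_, ?_⟩
    · intro v
      have := hd v
      rw [deg_sup_edge hne hn]
      grind
    · simp only [deg_sup_edge hne hn, Finset.sum_add_distrib]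
      simp
  · push Not at hfar
    have hx : deg G x < f x := by have := hxy x; simp at this; omega
    have hy : deg G y < f y := by have := hxy y; simp at this; omega
    obtain ⟨z, w, hzw, hzS, hxz, hyz, h⟩ := exists_switchable_edge f hf S hT hd hfar hx hy
    have hCd : C ≤ G.deleteEdges {s(z, w)} := by
      intro a b hab
      rw [deleteEdges_adj]
      refine ⟨hC hab, ?_⟩
      have h1 := hCS _ _ hab
      have h2 := hCS _ _ hab.symm
      simp only [mem_singleton_iff, Sym2.eq_iff]
      grind
    rcases h with hyw | hxw
    · obtain ⟨G', h1, h2, h3⟩ := exists_switch hm hG hzw hxz hyz hyw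
      refine ⟨G', hCd.trans h1, h2, fun v => h3 v ▸ hxy v, ?_⟩
      simp only [h3, Finset.sum_add_distrib]
      simp
    · obtain ⟨G', h1, h2, h3⟩ := exists_switch hm hG hzw hyz hxz hxw
      refine ⟨G', hCd.trans h1, h2, fun v => ?_, ?_⟩
      · rw [h3, add_right_comm]
        exact hxy v
      · simp only [h3, Finset.sum_add_distrib]
        simp

/-- Erdős–Sachs: a graph `C` of large girth extends to one with prescribed even-sum degrees `f`,
provided the maximal prescribed degree is attained often enough. -/
theorem exists_extension_deg_eq [Fintype V] {m k : ℕ} (hm : 2 ≤ m) (f : V → ℕ)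
    (hf : ∀ v, f v ≤ k) (hfe : Even (∑ v, f v)) {C : SimpleGraph V} (S : Finset V)
    (hCS : ∀ a b, C.Adj a b → a ∈ S)
    (hT : 2 * ∑ t ∈ Finset.range m, (k - 1) ^ t + S.card ≤ {v | f v = k}.ncard)
    (hC : ((m + 1 : ℕ) : ℕ∞) ≤ C.egirth) (hd : ∀ v, deg C v ≤ f v) :
    ∃ G : SimpleGraph V, C ≤ G ∧ ((m + 1 : ℕ) : ℕ∞) ≤ G.egirth ∧ ∀ v, deg G v = f v := by
  classical
  suffices H : ∀ n, ∀ G : SimpleGraph V, C ≤ G → ((m + 1 : ℕ) : ℕ∞) ≤ G.egirth →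
      (∀ v, deg G v ≤ f v) → ∑ v, f v - ∑ v, deg G v = n →
      ∃ G : SimpleGraph V, C ≤ G ∧ ((m + 1 : ℕ) : ℕ∞) ≤ G.egirth ∧ ∀ v, deg G v = f v from
    H _ C le_rfl hC hd rfl
  intro n
  induction n using Nat.strong_induction_on with
  | _ n ih =>
    intro G hCG hG hdG hn
    by_cases hall : ∀ v, deg G v = f v
    · exact ⟨G, hCG, hG, hall⟩
    push Not at hall
    obtain ⟨x, hx⟩ := hall
    have hx' : deg G x < f x := lt_of_le_of_ne (hdG x) hx
    obtain ⟨y, hxy⟩ : ∃ y, ∀ v,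
        deg G v + (if v = x then 1 else 0) + (if v = y then 1 else 0) ≤ f v := by
      by_contra! hcon
      have heq : ∀ v, f v = deg G v + (if v = x then 1 else 0) := by
        intro y
        obtain ⟨v, hv⟩ := hcon y
        have := hdG v
        have := hdG y
        grind
      have h2 : ∑ v, f v = ∑ v, deg G v + 1 := by
        simp only [heq, Finset.sum_add_distrib]
        simp
      rw [h2, Nat.even_add_one] at hfe
      exact hfe (sum_deg_even G)
    obtain ⟨G', h1, h2, h3, h4⟩ := exists_sum_deg_lt hm f hf S hCS hT hCG hG hdG hxy
    have h5 : ∑ v, deg G' v ≤ ∑ v, f v := Finset.sum_le_sum fun v _ => h3 v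
    exact ih _ (by omega) G' h1 h2 h3 rfl

/-- In a graph of maximum degree two, the vertices of a cycle are closed under adjacency. -/
theorem Walk.IsCycle.mem_support_of_adj [Finite V] (hG : ∀ v, deg G v ≤ 2) {a : V}
    {c : G.Walk a a} (hc : c.IsCycle) {u v : V} (hu : u ∈ c.support) (h : G.Adj u v) :
    v ∈ c.support := by
  have heq : c.toSubgraph.neighborSet u = G.neighborSet u :=
    eq_of_subset_of_ncard_le (c.toSubgraph.neighborSet_subset u)
      (by rw [hc.ncard_neighborSet_toSubgraph_eq_two hu]; exact hG u)
  have : v ∈ c.toSubgraph.neighborSet u := heq ▸ h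
  exact (c.mem_verts_toSubgraph).1 (c.toSubgraph.edge_vert (Subgraph.Adj.symm this))

theorem deg_map_cycleGraph_le [Finite V] {n : ℕ} (e : Fin (n + 3) ↪ V) (v : V) :
    deg ((cycleGraph (n + 3)).map e) v ≤ 2 := by
  by_cases hv : ∃ i, e i = v
  · obtain ⟨i, rfl⟩ := hv
    have : ((cycleGraph (n + 3)).map e).neighborSet (e i) ⊆ {e (i - 1), e (i + 1)} := by
      intro w hw
      rw [mem_neighborSet, map_adj] at hw
      obtain ⟨a, b, hab, ha, rfl⟩ := hw
      obtain rfl := e.injective ha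
      have : b ∈ (cycleGraph (n + 1 + 2)).neighborSet a := hab
      rw [cycleGraph_neighborSet] at this
      rcases this with rfl | rfl <;> simp
    exact (ncard_le_ncard this).trans ((ncard_insert_le _ _).trans (by simp))
  · have : ((cycleGraph (n + 3)).map e).neighborSet v = ∅ := by
      ext w
      simp only [mem_neighborSet, map_adj, mem_empty_iff_false, iff_false]
      rintro ⟨a, b, -, ha, -⟩
      exact hv ⟨a, ha⟩
    simp [deg, this]

theorem le_egirth_map_cycleGraph [Finite V] {n : ℕ} (e : Fin (n + 3) ↪ V) :
    ((n + 3 : ℕ) : ℕ∞) ≤ ((cycleGraph (n + 3)).map e).egirth := by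
  classical
  rw [le_egirth]
  intro a c hc
  have hstep : ∀ i j, (cycleGraph (n + 3)).Adj i j → e i ∈ c.support → e j ∈ c.support :=
    fun i j hij hi => hc.mem_support_of_adj (deg_map_cycleGraph_le e) hi
      ((map_adj ..).2 ⟨i, j, hij, rfl, rfl⟩)
  obtain ⟨i, hi⟩ : ∃ i, e i ∈ c.support := by
    have := c.adj_snd hc.not_nil
    rw [map_adj] at this
    obtain ⟨i, -, -, hi, -⟩ := this
    exact ⟨i, hi ▸ c.start_mem_support⟩
  have hmem : ∀ j, e j ∈ c.support := by
    intro j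
    obtain ⟨p⟩ := cycleGraph_preconnected i j
    induction p with
    | nil => exact hi
    | cons h _ ih => exact ih (hstep _ _ h hi)
  have hsub : Finset.univ.map e ⊆ c.support.tail.toFinset := by
    intro v hv
    simp only [Finset.mem_map, Finset.mem_univ, true_and] at hv
    obtain ⟨j, rfl⟩ := hv
    rw [List.mem_toFinset]
    rcases c.mem_support_iff.1 (hmem j) with h | h
    · rw [h]
      exact Walk.end_mem_tail_support hc.not_nil
    · exact h
  have h1 := (Finset.card_le_card hsub).trans (List.toFinset_card_le _)
  simp only [Finset.card_map, Finset.card_univ, Fintype.card_fin, List.length_tail,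
    Walk.length_support, Nat.add_sub_cancel] at h1
  exact_mod_cast h1

theorem girth_eq_of_map_cycleGraph_le {n : ℕ} (e : Fin (n + 3) ↪ V)
    (hle : (cycleGraph (n + 3)).map e ≤ G) (hG : ((n + 3 : ℕ) : ℕ∞) ≤ G.egirth) :
    G.girth = n + 3 := by
  have hc : ((cycleGraph.cycle n).map (Embedding.map e (cycleGraph (n + 3))).toHom).IsCycle :=
    (cycleGraph.isCycle_cycle).map e.injective
  have h := egirth_le_length (hc.mapLe hle)
  rw [Walk.length_mapLe, Walk.length_map, cycleGraph.length_cycle] at h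
  rw [girth, le_antisymm h hG, ENat.toNat_natCast]

end SimpleGraph

/-- existence of `(r,s;g)`-babi-graphs with the Erdős–Sachs type bound. -/
theorem stmt_5 (r s g : ℕ) (hr : 2 ≤ r) (hrs : r < s) (hg : 3 ≤ g) :
    ∃ (n : ℕ) (G : SimpleGraph (Fin n)), IsBabi r s g G ∧
      n ≤ 32 * (∑ t ∈ Finset.Icc 1 (g - 2), (r - 1) ^ t) *
           (∑ t ∈ Finset.Icc 1 (g - 2), (s - 1) ^ t) := by
  obtain ⟨k, rfl⟩ : ∃ k, g = k + 3 := ⟨g - 3, by omega⟩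
  set R := ∑ t ∈ Finset.Icc 1 (k + 3 - 2), (r - 1) ^ t
  set S := ∑ t ∈ Finset.Icc 1 (k + 3 - 2), (s - 1) ^ t with hS
  have le_sum : ∀ q, 2 ≤ q → k + 1 ≤ ∑ t ∈ Finset.Icc 1 (k + 3 - 2), (q - 1) ^ t := by
    intro q hq
    calc k + 1 = ∑ t ∈ Finset.Icc 1 (k + 3 - 2), 1 := by simp
      _ ≤ _ := Finset.sum_le_sum fun t _ => Nat.one_le_pow _ _ (by omega)
  have hRk : k + 1 ≤ R := le_sum r hr
  have hSk : k + 1 ≤ S := le_sum s (by omega)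
  have hsum : ∑ t ∈ Finset.range (k + 2), (s - 1) ^ t = S + 1 := by
    rw [Finset.sum_range_succ', hS, pow_zero, Finset.range_eq_Ico, Finset.sum_Ico_add' (fun t => (s - 1) ^ t)]
    rfl
  set N := 2 * (S + (k + 3))
  set f : Fin (N + N) → ℕ := Fin.append (fun _ : Fin N => r) (fun _ : Fin N => s)
  have hleft : ∀ i, f (Fin.castAdd N i) = r := Fin.append_left _ _
  have hright : ∀ i, f (Fin.natAdd N i) = s := Fin.append_right _ _
  have hfr : {v | f v = r} = range (Fin.castAdd N) := by
    ext v
    induction v using Fin.addCases with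
    | left i => exact iff_of_true (hleft i) (mem_range_self i)
    | right i =>
      simp only [mem_ofPred_eq, hright, mem_range, hrs.ne', false_iff, not_exists]
      intro j hj
      have := congrArg Fin.val hj
      simp at this
      omega
  have hfs : {v | f v = s} = range (Fin.natAdd N) := by
    ext v
    induction v using Fin.addCases with
    | left i =>
      simp only [mem_ofPred_eq, hleft, mem_range, hrs.ne, false_iff, not_exists]
      intro j hj
      have := congrArg Fin.val hj
      simp at this
      omega
    | right i => exact iff_of_true (hright i) (mem_range_self i)
  have hcr : {v | f v = r}.ncard = N := by
    rw [hfr, ← image_univ, ncard_image_of_injective _ (Fin.castAdd_injective _ _), ncard_univ,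
      Nat.card_fin]
  have hcs : {v | f v = s}.ncard = N := by
    rw [hfs, ← image_univ, ncard_image_of_injective _ (Fin.natAdd_injective _ _), ncard_univ,
      Nat.card_fin]
  have hrange : ∀ v, f v = r ∨ f v = s := fun v => by
    induction v using Fin.addCases with
    | left i => exact .inl (hleft i)
    | right i => exact .inr (hright i)
  have hle : ∀ v, 2 ≤ f v ∧ f v ≤ s := fun v => by
    rcases hrange v with h | h <;> omega
  have heven : Even (∑ v, f v) := by
    rw [Fin.sum_univ_add]
    simp only [hleft, hright, Finset.sum_const, Finset.card_univ,
      Fintype.card_fin, smul_eq_mul, ← mul_add]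
    exact (even_two_mul _).mul_right _
  let e : Fin (k + 3) ↪ Fin (N + N) := Fin.castLEEmb (by omega)
  obtain ⟨G, hCG, hG, hdeg⟩ := exists_extension_deg_eq (m := k + 2) (k := s) (by omega) f
    (fun v => (hle v).2) heven (C := (cycleGraph (k + 3)).map e) (Finset.univ.map e)
    (by
      intro a b hab
      obtain ⟨i, -, -, rfl, -⟩ := (map_adj ..).1 hab
      simp)
    (by
      rw [hsum, hcs, Finset.card_map, Finset.card_univ, Fintype.card_fin]
      omega)
    (le_egirth_map_cycleGraph e) (fun v => (deg_map_cycleGraph_le e v).trans (hle v).1)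
  have hNpos : 0 < N := by omega
  refine ⟨N + N, G, ⟨girth_eq_of_map_cycleGraph_le e hCG hG, ?_, ?_, ?_, ?_⟩, ?_⟩
  · simpa only [hdeg] using hrange
  · exact ⟨Fin.castAdd N ⟨0, hNpos⟩, (hdeg _).trans (hleft _)⟩
  · exact ⟨Fin.natAdd N ⟨0, hNpos⟩, (hdeg _).trans (hright _)⟩
  · simp only [hdeg, hcr, hcs]
  · calc N + N ≤ 32 * 1 * S := by omega
      _ ≤ 32 * R * S := by gcongr; omega
end

section
/- Let 2 ≤ r < s be integers and let G be an (r,s;g)-balanced biregular graph with g ≥ 3 odd and g > 3. Then the order of G is at least 1 + s + (rs + (s−r)² − s)·(1 + (r−1) + ⋯ + (r−1)^{(g−5)/2}). -/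
open SimpleGraph Set

/-- Two paths with the same endpoints and total length below the girth coincide. -/
theorem SimpleGraph.Walk.IsPath.eq_of_length_add_length_lt_girth {V : Type*} {G : SimpleGraph V}
    {u v : V} {p q : G.Walk u v} (hp : p.IsPath) (hq : q.IsPath)
    (hlen : p.length + q.length < G.girth) : p = q := by
  classical
  set H : SimpleGraph V := SimpleGraph.fromEdgeSet {e | e ∈ p.edges ∨ e ∈ q.edges} with hH
  have mem_H : ∀ e, e ∈ H.edgeSet → e ∈ p.edges ∨ e ∈ q.edges := by
    intro e he
    rw [hH, SimpleGraph.edgeSet_fromEdgeSet] at he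
    exact he.1
  have H_le : H ≤ G := by
    rw [← SimpleGraph.edgeSet_subset_edgeSet]
    intro e he
    exact (mem_H e he).elim (fun h => p.edges_subset_edgeSet h) (fun h => q.edges_subset_edgeSet h)
  have acyclic : H.IsAcyclic := by
    intro a c hc
    have hle : c.edges.toFinset ⊆ p.edges.toFinset ∪ q.edges.toFinset := by
      intro e he
      simpa using mem_H e (c.edges_subset_edgeSet (by simpa using he))
    have hcard := (Finset.card_le_card hle).trans (Finset.card_union_le _ _)
    rw [List.toFinset_card_of_nodup hc.isTrail.edges_nodup, c.length_edges] at hcard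
    have hp' := p.length_edges ▸ p.edges.toFinset_card_le
    have hq' := q.length_edges ▸ q.edges.toFinset_card_le
    have hg := SimpleGraph.girth_le_length (hc.mapLe H_le)
    rw [SimpleGraph.Walk.length_mapLe] at hg
    omega
  have hpH : ∀ e ∈ p.edges, e ∈ H.edgeSet := by
    intro e he
    rw [hH, SimpleGraph.edgeSet_fromEdgeSet]
    exact ⟨Or.inl he, G.not_isDiag_of_mem_edgeSet (p.edges_subset_edgeSet he)⟩
  have hqH : ∀ e ∈ q.edges, e ∈ H.edgeSet := by
    intro e he
    rw [hH, SimpleGraph.edgeSet_fromEdgeSet]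
    exact ⟨Or.inr he, G.not_isDiag_of_mem_edgeSet (q.edges_subset_edgeSet he)⟩
  have heq := (acyclic.subsingleton_path u v).elim
    ⟨p.transfer H hpH, hp.transfer hpH⟩ ⟨q.transfer H hqH, hq.transfer hqH⟩
  have hsupp := congrArg (fun x : H.Path u v => x.1.support) heq
  simp only [SimpleGraph.Walk.support_transfer] at hsupp
  exact SimpleGraph.Walk.ext_support hsupp

/-- A shortest path to a neighbor `u` of `w` that is no farther away than `w` extends to a path
to `w`. -/
theorem SimpleGraph.Adj.exists_isPath_penultimate_eq {V : Type*} {G : SimpleGraph V} {v u w : V}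
    (hadj : G.Adj u w) (hw : G.Reachable v w) (hle : G.dist v u ≤ G.dist v w) :
    ∃ p : G.Walk v w, p.IsPath ∧ p.length = G.dist v u + 1 ∧ p.penultimate = u := by
  classical
  obtain ⟨p, hp, hlen⟩ := (hw.trans hadj.symm.reachable).exists_path_of_dist
  refine ⟨p.concat hadj, hp.concat (fun hmem => ?_) hadj, by simp [hlen], by simp⟩
  have hlt := SimpleGraph.Walk.length_takeUntil_lt_length hmem hadj.ne'
  have hdist := SimpleGraph.dist_le (p.takeUntil w hmem)
  omega

/-- Below the girth, a vertex has at most one neighbor that is no farther from `v` than itself. -/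
theorem SimpleGraph.eq_of_adj_of_dist_le {V : Type*} {G : SimpleGraph V} {v w a b : V}
    (hw : G.Reachable v w) (ha : G.Adj a w) (hb : G.Adj b w)
    (hda : G.dist v a ≤ G.dist v w) (hdb : G.dist v b ≤ G.dist v w)
    (hlt : G.dist v a + G.dist v b + 2 < G.girth) : a = b := by
  obtain ⟨p, hp, hpl, hpa⟩ := ha.exists_isPath_penultimate_eq hw hda
  obtain ⟨q, hq, hql, hqb⟩ := hb.exists_isPath_penultimate_eq hw hdb
  rw [← hpa, ← hqb, hp.eq_of_length_add_length_lt_girth hq (by omega)]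

/-- Below the girth, every vertex at distance `j` from `v` contributes all but one of its neighbors
to the sphere of radius `j + 1`, without repetition. -/
theorem SimpleGraph.sum_degree_sub_one_le_card_dist_eq {V : Type*} [Fintype V] [DecidableEq V]
    (G : SimpleGraph V) [DecidableRel G.Adj] (v : V) {j : ℕ} (hj : 1 ≤ j)
    (hgirth : 2 * j + 2 < G.girth) :
    ∑ a ∈ Finset.univ.filter (fun a => G.dist v a = j), (G.degree a - 1) ≤
      (Finset.univ.filter (fun a => G.dist v a = j + 1)).card := by
  have hdisj : (↑(Finset.univ.filter (fun a => G.dist v a = j)) : Set V).PairwiseDisjoint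
      (fun a => (G.neighborFinset a).filter (fun u => G.dist v u = j + 1)) := by
    intro a ha b hb hab
    refine Finset.disjoint_left.2 fun c hca hcb => hab ?_
    simp only [Finset.coe_filter, Finset.mem_univ, true_and, Set.mem_ofPred_eq] at ha hb
    simp only [Finset.mem_filter, SimpleGraph.mem_neighborFinset] at hca hcb
    have hc : G.Reachable v c := SimpleGraph.Reachable.of_dist_ne_zero (by omega)
    exact SimpleGraph.eq_of_adj_of_dist_le hc hca.1 hcb.1 (by omega) (by omega) (by omega)
  calc
    _ ≤ ∑ a ∈ Finset.univ.filter (fun a => G.dist v a = j),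
        ((G.neighborFinset a).filter (fun u => G.dist v u = j + 1)).card := by
      refine Finset.sum_le_sum fun a ha => ?_
      have ha : G.dist v a = j := by simpa using ha
      have hreach : G.Reachable v a := SimpleGraph.Reachable.of_dist_ne_zero (by omega)
      have hone : ((G.neighborFinset a).filter (fun u => ¬ G.dist v u = j + 1)).card ≤ 1 := by
        have hle : ∀ u ∈ (G.neighborFinset a).filter (fun u => ¬ G.dist v u = j + 1),
            G.Adj u a ∧ G.dist v u ≤ j := by
          intro u hu
          simp only [Finset.mem_filter, SimpleGraph.mem_neighborFinset] at hu
          have htri := hreach.dist_triangle_left u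
          rw [SimpleGraph.dist_eq_one_iff_adj.2 hu.1] at htri
          exact ⟨hu.1.symm, by omega⟩
        refine Finset.card_le_one.2 fun b hb c hc => ?_
        obtain ⟨hb, hdb⟩ := hle b hb
        obtain ⟨hc, hdc⟩ := hle c hc
        exact SimpleGraph.eq_of_adj_of_dist_le hreach hb hc (by omega) (by omega) (by omega)
      have hsplit := Finset.card_filter_add_card_filter_not (s := G.neighborFinset a)
        (fun u => G.dist v u = j + 1)
      rw [SimpleGraph.card_neighborFinset_eq_degree] at hsplit
      omega
    _ = (((Finset.univ.filter (fun a => G.dist v a = j))).biUnion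
        (fun a => (G.neighborFinset a).filter (fun u => G.dist v u = j + 1))).card :=
      (Finset.card_biUnion hdisj).symm
    _ ≤ _ := by
      refine Finset.card_le_card fun c hc => ?_
      simp only [Finset.mem_biUnion, Finset.mem_filter] at hc
      obtain ⟨_, _, _, hc⟩ := hc
      simpa using hc

/-- Moore-type bound: minimum degree `r` and `N` counted vertices at distance two force geometric
growth of the spheres around `v` up to half the girth. -/
theorem SimpleGraph.moore_bound_of_sum_degree_sub_one {V : Type*} [Fintype V] [DecidableEq V]
    (G : SimpleGraph V) [DecidableRel G.Adj] (v : V) {r N m : ℕ} (hmin : ∀ a, r ≤ G.degree a)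
    (hN : N ≤ ∑ a ∈ G.neighborFinset v, (G.degree a - 1)) (hgirth : 2 * m + 4 < G.girth) :
    1 + G.degree v + N * ∑ t ∈ Finset.range (m + 1), (r - 1) ^ t ≤ Fintype.card V := by
  have hone : Finset.univ.filter (fun a => G.dist v a = 1) = G.neighborFinset v := by
    ext a
    simp [SimpleGraph.dist_eq_one_iff_adj]
  have hgrowth : ∀ t ≤ m, N * (r - 1) ^ t ≤
      (Finset.univ.filter (fun a => G.dist v a = t + 2)).card := by
    intro t
    induction t with
    | zero =>
      intro _
      have h := G.sum_degree_sub_one_le_card_dist_eq v (j := 1) le_rfl (by omega)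
      rw [hone] at h
      simpa using hN.trans h
    | succ t ih =>
      intro ht
      refine le_trans ?_ (G.sum_degree_sub_one_le_card_dist_eq v (j := t + 2) (by omega) (by omega))
      refine le_trans ?_ (Finset.card_nsmul_le_sum _ _ (r - 1)
        fun a _ => Nat.sub_le_sub_right (hmin a) 1)
      rw [pow_succ, ← mul_assoc, smul_eq_mul]
      exact Nat.mul_le_mul_right _ (ih (by omega))
  have hzero : 1 ≤ (Finset.univ.filter (fun a => G.dist v a = 0)).card :=
    Finset.card_pos.2 ⟨v, by simp⟩
  have htotal : ∑ j ∈ Finset.range (m + 3), (Finset.univ.filter (fun a => G.dist v a = j)).card ≤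
      Fintype.card V := by
    rw [← Finset.card_biUnion]
    · exact Finset.card_le_univ _
    · intro i _ j _ hij
      refine Finset.disjoint_left.2 fun a hi hj => hij ?_
      simp only [Finset.mem_filter] at hi hj
      exact hi.2.symm.trans hj.2
  rw [Finset.sum_range_succ', Finset.sum_range_succ'] at htotal
  have hsum : N * ∑ t ∈ Finset.range (m + 1), (r - 1) ^ t ≤
      ∑ t ∈ Finset.range (m + 1), (Finset.univ.filter (fun a => G.dist v a = t + 1 + 1)).card := by
    rw [Finset.mul_sum]
    exact Finset.sum_le_sum fun t ht => hgrowth t (by simpa [Nat.lt_succ_iff] using ht)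
  rw [zero_add, hone, SimpleGraph.card_neighborFinset_eq_degree] at htotal
  omega

/-- If there are as many vertices of degree `s` as of degree `r`, some vertex of degree `s` has at
most `r` neighbors of degree `r`. -/
theorem SimpleGraph.exists_degree_eq_and_card_neighbors_le {V : Type*} [Fintype V] [DecidableEq V]
    (G : SimpleGraph V) [DecidableRel G.Adj] {r s : ℕ} (hs : ∃ v, G.degree v = s)
    (hcard : (Finset.univ.filter (fun v => G.degree v = r)).card =
      (Finset.univ.filter (fun v => G.degree v = s)).card) :
    ∃ v, G.degree v = s ∧
      ((G.neighborFinset v).filter (fun a => G.degree a = r)).card ≤ r := by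
  obtain ⟨v₀, hv₀⟩ := hs
  have hsum : ∑ v ∈ Finset.univ.filter (fun v => G.degree v = s),
      ((G.neighborFinset v).filter (fun a => G.degree a = r)).card ≤
      ∑ _v ∈ Finset.univ.filter (fun v => G.degree v = s), r := by
    calc
      _ = ∑ v ∈ Finset.univ.filter (fun v => G.degree v = s),
          ((Finset.univ.filter (fun a => G.degree a = r)).bipartiteAbove G.Adj v).card := by
        refine Finset.sum_congr rfl fun v _ => congrArg Finset.card ?_
        ext a
        simp [Finset.bipartiteAbove, and_comm]
      _ = ∑ a ∈ Finset.univ.filter (fun a => G.degree a = r),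
          ((Finset.univ.filter (fun v => G.degree v = s)).bipartiteBelow G.Adj a).card :=
        Finset.sum_card_bipartiteAbove_eq_sum_card_bipartiteBelow _
      _ ≤ ∑ _a ∈ Finset.univ.filter (fun a => G.degree a = r), r := by
        refine Finset.sum_le_sum fun a ha => ?_
        have ha : G.degree a = r := by simpa using ha
        rw [← ha, ← SimpleGraph.card_neighborFinset_eq_degree]
        refine Finset.card_le_card fun v hv => ?_
        simp only [Finset.bipartiteBelow, Finset.mem_filter] at hv
        simpa using hv.2.symm
      _ = _ := by simp [hcard]
  obtain ⟨v, hv, hle⟩ := Finset.exists_le_of_sum_le ⟨v₀, by simpa using hv₀⟩ hsum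
  exact ⟨v, by simpa using hv, hle⟩

/-- In a graph with degrees `r < s`, a vertex of degree `s` with at most `r` neighbors of degree `r`
has many vertices at distance two. -/
theorem SimpleGraph.le_sum_neighbors_degree_sub_one {V : Type*} [Fintype V] [DecidableEq V]
    (G : SimpleGraph V) [DecidableRel G.Adj] {r s : ℕ} (hr : 1 ≤ r) (hrs : r < s)
    (hdeg : ∀ v, G.degree v = r ∨ G.degree v = s) {v : V} (hv : G.degree v = s)
    (hle : ((G.neighborFinset v).filter (fun a => G.degree a = r)).card ≤ r) :
    r * s + (s - r) ^ 2 - s ≤ ∑ a ∈ G.neighborFinset v, (G.degree a - 1) := by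
  have hsplit := Finset.card_filter_add_card_filter_not (s := G.neighborFinset v)
    (fun a => G.degree a = r)
  rw [SimpleGraph.card_neighborFinset_eq_degree, hv] at hsplit
  rw [← Finset.sum_filter_add_sum_filter_not (G.neighborFinset v) (fun a => G.degree a = r),
    Finset.sum_congr rfl (g := fun _ => r - 1)
      (fun a ha => by rw [(Finset.mem_filter.1 ha).2]),
    Finset.sum_congr (s₁ := (G.neighborFinset v).filter (fun a => ¬ G.degree a = r)) rfl
      (g := fun _ => s - 1)
      (fun a ha => by rw [(hdeg a).resolve_left (Finset.mem_filter.1 ha).2]),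
    Finset.sum_const, Finset.sum_const, smul_eq_mul, smul_eq_mul]
  generalize ((G.neighborFinset v).filter (fun a => G.degree a = r)).card = x at *
  generalize ((G.neighborFinset v).filter (fun a => ¬ G.degree a = r)).card = y at *
  obtain ⟨r, rfl⟩ := Nat.exists_eq_add_of_le' hr
  obtain ⟨d, rfl⟩ := Nat.exists_eq_add_of_lt hrs
  obtain ⟨e, he⟩ := Nat.exists_eq_add_of_le hle
  have hy : y = d + 1 + e := by omega
  rw [show r + 1 + d + 1 - (r + 1) = d + 1 by omega, show r + 1 - 1 = r by omega,
    show r + 1 + d + 1 - 1 = r + 1 + d by omega, Nat.sub_le_iff_le_add, hy]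
  nlinarith [Nat.zero_le (e * d)]

/-- Moore-type lower bound for odd girth `g > 3`. -/
theorem stmt_6 (r s g n : ℕ) (hr : 2 ≤ r) (hrs : r < s) (hodd : Odd g) (hg : 3 < g)
    (G : SimpleGraph (Fin n)) (h : IsBabi r s g G) :
    1 + s + (r * s + (s - r) ^ 2 - s) *
      (∑ t ∈ Finset.range ((g - 5) / 2 + 1), (r - 1) ^ t) ≤ n := by
  classical
  obtain ⟨hgirth, hdeg, -, hs, hcard⟩ := h
  have deg_eq : ∀ v, deg G v = G.degree v := by
    intro v
    rw [deg, Set.ncard_eq_toFinset_card', ← SimpleGraph.card_neighborFinset_eq_degree]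
    rfl
  simp only [deg_eq] at hdeg hs hcard
  rw [Set.ncard_eq_toFinset_card', Set.ncard_eq_toFinset_card', Set.toFinset_ofPred,
    Set.toFinset_ofPred] at hcard
  obtain ⟨v, hv, hle⟩ := G.exists_degree_eq_and_card_neighbors_le hs hcard
  obtain ⟨k, rfl⟩ := hodd
  have hbound := G.moore_bound_of_sum_degree_sub_one v (r := r) (m := (2 * k + 1 - 5) / 2)
    (fun a => by rcases hdeg a with ha | ha <;> omega)
    (G.le_sum_neighbors_degree_sub_one (by omega) hrs hdeg hv hle) (by omega)
  rwa [hv, Fintype.card_fin] at hbound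
end
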